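/- arXiv:2007.00187 — 2 statements merged into one kernel-verified Lean document; each statement's English description precedes it below -/
import Mathlib

section
/- There exist constants C₁ > 0 and C₂ > 0 such that for every α ∈ (0, 1/2], every integer j > 8/α, and every p = (p_1,…,p_j) ∈ [0,1]^j with p_l ≥ 1/2 + α for all l, one has Σ_{s=0}^{j} f_p(j,s) / F_{j+1,1/2}(s) ≤ 1 + 1/(exp(α²j/4) − 1) + exp(−α²j/2) · (C₁ + C₂ · (1 − 2α)/(4α²(j+1))). -/
open Finset

/-- Probability that exactly `s` of `j` independent Bernoulli trials with
success probabilities `p` succeed. -/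
noncomputable def bernCount (j : ℕ) (p : Fin j → ℝ) (s : ℕ) : ℝ :=
  ∑ B ∈ Finset.powersetCard s (Finset.univ : Finset (Fin j)),
    (∏ l ∈ B, p l) * ∏ l ∈ Bᶜ, (1 - p l)

/-- CDF of the Binomial(n, q) distribution at `s`. -/
noncomputable def binCDF (n : ℕ) (q : ℝ) (s : ℕ) : ℝ :=
  ∑ k ∈ Finset.range (s + 1), (n.choose k : ℝ) * q ^ k * (1 - q) ^ (n - k)

/-- The number of subsets of an `n`-element set with at most `s` elements. -/
def chooseSum (n s : ℕ) : ℕ := ∑ k ∈ Finset.range (s + 1), n.choose k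

lemma binCDF_half (n s : ℕ) : binCDF n (1 / 2) s = (chooseSum n s : ℝ) / 2 ^ n := by
  unfold binCDF chooseSum
  push_cast
  rw [Finset.sum_div]
  refine Finset.sum_congr rfl fun k _ => ?_
  rcases le_or_gt k n with h | h
  · have : (1 / 2 : ℝ) ^ k * (1 - 1 / 2) ^ (n - k) = 1 / 2 ^ n := by
      rw [show (1 - 1 / 2 : ℝ) = 1 / 2 by norm_num, ← pow_add, Nat.add_sub_cancel' h]
      simp
    rw [mul_assoc, this]
    ring
  · simp [Nat.choose_eq_zero_of_lt h]

lemma chooseSum_pos (n s : ℕ) : 0 < chooseSum n s :=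
  Finset.sum_pos' (fun _ _ => Nat.zero_le _) ⟨0, by simp, by simp⟩

lemma chooseSum_mono (n : ℕ) : Monotone (chooseSum n) := fun _ _ h =>
  Finset.sum_le_sum_of_subset (Finset.range_subset_range.2 (by omega))

lemma binCDF_half_pos (n s : ℕ) : 0 < binCDF n (1 / 2) s := by
  rw [binCDF_half]
  have : (0 : ℝ) < chooseSum n s := by exact_mod_cast chooseSum_pos n s
  positivity

lemma antitone_inv_binCDF_half (n : ℕ) : Antitone fun s => 1 / binCDF n (1 / 2) s := by
  intro s t h
  refine one_div_le_one_div_of_le (binCDF_half_pos n s) ?_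
  rw [binCDF_half, binCDF_half]
  have : (chooseSum n s : ℝ) ≤ chooseSum n t := by exact_mod_cast chooseSum_mono n h
  gcongr

/-- At least half of the mass of the symmetric binomial distribution lies at or below `s`
once `n ≤ 2 * s + 1`. -/
lemma half_le_binCDF_half {n s : ℕ} (h : n ≤ 2 * s + 1) : 1 / 2 ≤ binCDF n (1 / 2) s := by
  have key : 2 ^ n ≤ 2 * chooseSum n s := by
    rw [← Nat.sum_range_choose]
    have hsplit : ∑ k ∈ Finset.range (n + 1), n.choose k ≤
        ∑ k ∈ Finset.range ((s + 1) + (n - s)), n.choose k :=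
      Finset.sum_le_sum_of_subset (Finset.range_subset_range.2 (by omega))
    rw [Finset.sum_range_add _ (s + 1)] at hsplit
    have htail : ∑ k ∈ Finset.range (n - s), n.choose (s + 1 + k) ≤ chooseSum n s := by
      rw [← Finset.sum_range_reflect]
      refine le_trans (Finset.sum_le_sum (g := fun k => n.choose k) fun k hk => ?_)
        (Finset.sum_le_sum_of_subset (Finset.range_subset_range.2 (by omega)))
      rw [Finset.mem_range] at hk
      rw [show s + 1 + (n - s - 1 - k) = n - k by omega, Nat.choose_symm (by omega)]
    unfold chooseSum at *
    omega
  rw [binCDF_half, div_le_div_iff₀ (by norm_num) (by positivity)]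
  have : (2 : ℝ) ^ n ≤ 2 * chooseSum n s := by exact_mod_cast key
  linarith

/-- Chernoff bound for the upper tail of the symmetric binomial distribution. -/
lemma one_sub_binCDF_half_le (n s : ℕ) {z : ℝ} (hz : 1 ≤ z) :
    1 - binCDF n (1 / 2) s ≤ ((1 + z) / 2) ^ n / z ^ (s + 1) := by
  have hz0 : 0 < z := by linarith
  have hpoint : ∀ k, (if s < k then (1 : ℝ) else 0) ≤ z ^ k / z ^ (s + 1) := by
    intro k
    split_ifs with h
    · rw [one_le_div (by positivity)]
      exact pow_le_pow_right₀ hz h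
    · positivity
  have htotal : (2 : ℝ) ^ n ≤ chooseSum n s +
      ∑ k ∈ Finset.range (n + 1), (if s < k then (1 : ℝ) else 0) * n.choose k := by
    have h1 : (2 : ℝ) ^ n = ∑ k ∈ Finset.range (n + 1), (n.choose k : ℝ) := by
      exact_mod_cast (Nat.sum_range_choose n).symm
    have h2 : ∑ k ∈ Finset.range (n + 1), (if k < s + 1 then (n.choose k : ℝ) else 0) ≤
        chooseSum n s := by
      rw [← Finset.sum_filter]
      unfold chooseSum
      push_cast
      refine Finset.sum_le_sum_of_subset_of_nonneg (fun k hk => ?_) fun _ _ _ => by positivity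
      simp only [Finset.mem_filter, Finset.mem_range] at hk ⊢
      exact hk.2
    rw [h1]
    refine le_trans (le_of_eq ?_) (add_le_add_left h2 _)
    rw [← Finset.sum_add_distrib]
    refine Finset.sum_congr rfl fun k _ => ?_
    by_cases h : s < k
    · simp [h, show ¬ k < s + 1 by omega]
    · simp [h, show k < s + 1 by omega]
  have hmgf : ∑ k ∈ Finset.range (n + 1), (if s < k then (1 : ℝ) else 0) * n.choose k ≤
      (1 + z) ^ n / z ^ (s + 1) := by
    rw [add_comm 1 z, add_pow, Finset.sum_div]
    refine Finset.sum_le_sum fun k _ => ?_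
    refine le_trans (mul_le_mul_of_nonneg_right (hpoint k) (by positivity)) (le_of_eq ?_)
    simp
    ring
  rw [binCDF_half, div_pow, div_right_comm, sub_le_iff_le_add, ← add_div,
    le_div_iff₀ (by positivity)]
  linarith

/-- An upper bound for the reversed hazard rate of the symmetric binomial distribution. -/
lemma choose_le_mul_chooseSum (n : ℕ) : ∀ s : ℕ, 2 * s ≤ n →
    (n.choose s : ℝ) ≤
      (2 * (n + 1 - 2 * s) / (n + 2) + 2 / Real.sqrt (n + 2)) * chooseSum n s := by
  have hε : 0 < 2 / Real.sqrt ((n : ℝ) + 2) := by positivity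
  have hε2 : (2 / Real.sqrt ((n : ℝ) + 2)) ^ 2 = 4 / (n + 2) := by
    rw [div_pow, Real.sq_sqrt (by positivity)]
    norm_num
  set ε := 2 / Real.sqrt ((n : ℝ) + 2)
  intro s
  induction s with
  | zero =>
    intro _
    have h : (1 : ℝ) ≤ 2 * (n + 1) / (n + 2) := by
      rw [le_div_iff₀ (by positivity)]
      have : (0 : ℝ) ≤ n := by positivity
      linarith
    simp [chooseSum]
    linarith
  | succ s ih =>
    intro hs
    have ih := ih (by omega)
    have hsn : (2 : ℝ) * s + 2 ≤ n := by exact_mod_cast hs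
    have hs0 : (0 : ℝ) ≤ s := by positivity
    have hrec : (n.choose (s + 1) : ℝ) * (s + 1) = n.choose s * (n - s) := by
      have := Nat.choose_succ_right_eq n s
      rw [← Nat.cast_sub (by omega)]
      exact_mod_cast this
    have hsum : (chooseSum n (s + 1) : ℝ) = chooseSum n s + n.choose (s + 1) := by
      simp [chooseSum, Finset.sum_range_succ _ (s + 1)]
    rw [hsum]
    push_cast
    have hN : (0 : ℝ) < chooseSum n s := by exact_mod_cast chooseSum_pos n s
    have hc' : (0 : ℝ) ≤ n.choose (s + 1) := by positivity
    set N : ℝ := (chooseSum n s : ℝ)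
    set c' : ℝ := (n.choose (s + 1) : ℝ)
    set v : ℝ := 2 * (n + 1 - 2 * (s + 1)) / (n + 2) + ε with hv
    set δ : ℝ := 4 / ((n : ℝ) + 2)
    have hv' : (2 * (n + 1 - 2 * s) / (n + 2) + ε : ℝ) = v + δ := by
      rw [hv]
      simp only [δ]
      field_simp
      ring
    rw [hv'] at ih
    have hδ : 0 < δ := by positivity
    have hns : (0 : ℝ) < n - s := by linarith
    have hrle : 1 - (s + 1) / (n - s : ℝ) ≤ v - ε := by
      have h1 : 1 - (s + 1) / (n - s : ℝ) = (n - 2 * s - 1) / (n - s) := by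
        field_simp
        ring
      have h2 : v - ε = (n - 2 * s - 1) / ((n + 2) / 2) := by
        rw [hv]
        field_simp
        ring
      rw [h1, h2]
      exact div_le_div_of_nonneg_left (by linarith) (by linarith) (by linarith)
    have hvε : ε ≤ v := by
      rw [hv]
      have : (0 : ℝ) ≤ 2 * (n + 1 - 2 * (s + 1)) / (n + 2) :=
        div_nonneg (by linarith) (by positivity)
      linarith
    have hcρ : (n.choose s : ℝ) = c' * ((s + 1) / (n - s)) := by
      field_simp
      linarith
    rw [hcρ] at ih
    set ρ : ℝ := (s + 1) / (n - s)
    have hvpos : 0 < v := by linarith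
    have hstep : (1 - v) * (v + δ) ≤ v * ρ := by
      nlinarith [mul_le_mul hvε (show ε ≤ v - (1 - ρ) by linarith) hε.le hvpos.le,
        mul_pos hδ hvpos]
    have hmain : c' * (1 - v) * (v + δ) ≤ v * N * (v + δ) := by
      nlinarith [mul_le_mul_of_nonneg_left hstep hc', mul_le_mul_of_nonneg_left ih hvpos.le]
    have := le_of_mul_le_mul_right hmain (by linarith)
    linarith

/-- Expectation of `W` at the number of successes, for independent trials indexed by `T` with
success probabilities `p`. -/
noncomputable def countExp {ι : Type*} [DecidableEq ι] (T : Finset ι) (p : ι → ℝ) (W : ℕ → ℝ) :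
    ℝ :=
  ∑ B ∈ T.powerset, ((∏ l ∈ B, p l) * ∏ l ∈ T \ B, (1 - p l)) * W B.card

section countExp

variable {ι : Type*} [DecidableEq ι]

lemma countExp_insert {a : ι} {T : Finset ι} (ha : a ∉ T) (p : ι → ℝ) (W : ℕ → ℝ) :
    countExp (insert a T) p W =
      (1 - p a) * countExp T p W + p a * countExp T p fun s => W (s + 1) := by
  unfold countExp
  rw [Finset.sum_powerset_insert ha, Finset.mul_sum, Finset.mul_sum]
  congr 1 <;> refine Finset.sum_congr rfl fun B hB => ?_
  · have haB : a ∉ B := fun h => ha (Finset.mem_powerset.1 hB h)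
    rw [Finset.insert_sdiff_of_notMem _ haB, Finset.prod_insert (by simp [ha])]
    ring
  · have haB : a ∉ B := fun h => ha (Finset.mem_powerset.1 hB h)
    rw [Finset.insert_sdiff_insert, Finset.sdiff_insert_of_notMem ha, Finset.prod_insert haB,
      Finset.card_insert_of_notMem haB]
    ring

lemma countExp_mono {T : Finset ι} {p : ι → ℝ} (h0 : ∀ l, 0 ≤ p l) (h1 : ∀ l, p l ≤ 1)
    {W W' : ℕ → ℝ} (h : ∀ s, W s ≤ W' s) : countExp T p W ≤ countExp T p W' := by
  refine Finset.sum_le_sum fun B _ => mul_le_mul_of_nonneg_left (h _) ?_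
  exact mul_nonneg (Finset.prod_nonneg fun l _ => h0 l)
    (Finset.prod_nonneg fun l _ => sub_nonneg.2 (h1 l))

/-- Stochastic domination: raising the success probabilities lowers the expectation of a
decreasing function of the number of successes. -/
lemma countExp_anti {p r : ι → ℝ} (hp1 : ∀ l, p l ≤ 1) (hr0 : ∀ l, 0 ≤ r l)
    (hrp : ∀ l, r l ≤ p l) (T : Finset ι) :
    ∀ W : ℕ → ℝ, Antitone W → countExp T p W ≤ countExp T r W := by
  induction T using Finset.induction_on with
  | empty => intro W _; simp [countExp]
  | insert a T ha ih =>
    intro W hW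
    rw [countExp_insert ha, countExp_insert ha]
    have hW' : Antitone fun s => W (s + 1) := fun s t h => hW (by omega)
    have hsucc : countExp T p (fun s => W (s + 1)) ≤ countExp T p W :=
      countExp_mono (fun l => (hr0 l).trans (hrp l)) hp1 fun s => hW (Nat.le_succ s)
    have e1 := mul_le_mul_of_nonneg_left (ih W hW)
      (sub_nonneg.2 ((hrp a).trans (hp1 a)))
    have e2 := mul_le_mul_of_nonneg_left (ih _ hW') (hr0 a)
    nlinarith [mul_le_mul_of_nonneg_left hsucc (sub_nonneg.2 (hrp a))]

end countExp

lemma sum_bernCount_mul (j : ℕ) (p : Fin j → ℝ) (W : ℕ → ℝ) :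
    ∑ s ∈ Finset.range (j + 1), bernCount j p s * W s = countExp Finset.univ p W := by
  unfold countExp bernCount
  rw [Finset.sum_powerset]
  simp only [Finset.card_univ, Fintype.card_fin]
  refine Finset.sum_congr rfl fun s _ => ?_
  rw [Finset.sum_mul]
  refine Finset.sum_congr rfl fun B hB => ?_
  rw [(Finset.mem_powersetCard.1 hB).2, Finset.compl_eq_univ_sdiff]

lemma bernCount_const (j : ℕ) (q : ℝ) (s : ℕ) :
    bernCount j (fun _ => q) s = j.choose s * q ^ s * (1 - q) ^ (j - s) := by
  unfold bernCount
  rw [Finset.sum_congr rfl (g := fun _ => q ^ s * (1 - q) ^ (j - s))]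
  · simp [mul_assoc]
  · intro B hB
    have hB := (Finset.mem_powersetCard.1 hB).2
    simp [Finset.card_compl, hB]

lemma sum_bernCount_div_binCDF_le {j : ℕ} {p : Fin j → ℝ} {q : ℝ} (hq : 0 ≤ q)
    (hp1 : ∀ l, p l ≤ 1) (hqp : ∀ l, q ≤ p l) (n : ℕ) :
    ∑ s ∈ Finset.range (j + 1), bernCount j p s / binCDF n (1 / 2) s ≤
      ∑ s ∈ Finset.range (j + 1),
        j.choose s * q ^ s * (1 - q) ^ (j - s) / binCDF n (1 / 2) s := by
  have h := countExp_anti hp1 (fun _ => hq) hqp Finset.univ _ (antitone_inv_binCDF_half n)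
  rw [← sum_bernCount_mul, ← sum_bernCount_mul] at h
  simpa only [mul_one_div, bernCount_const] using h

/-- The contribution of the upper half of the range. -/
lemma sum_binomial_mul_tail_le {α : ℝ} (h0 : 0 < α) (h1 : α ≤ 1 / 2) (j : ℕ) :
    ∑ s ∈ Finset.range (j + 1), j.choose s * (1 / 2 + α) ^ s * (1 - (1 / 2 + α)) ^ (j - s) *
      (1 + 2 * (((1 + (1 + 2 * α)) / 2) ^ (j + 1) / (1 + 2 * α) ^ (s + 1))) ≤
    1 + 2 * Real.exp (-(α ^ 2) * j) := by
  have hz : 0 < 1 + 2 * α := by linarith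
  have hone : ∑ s ∈ Finset.range (j + 1),
      j.choose s * (1 / 2 + α) ^ s * (1 - (1 / 2 + α)) ^ (j - s) = 1 := by
    have h := add_pow (1 / 2 + α) (1 - (1 / 2 + α)) j
    rw [add_sub_cancel, one_pow] at h
    refine Eq.trans ?_ h.symm
    exact Finset.sum_congr rfl fun s _ => by ring
  have hmgf : ∑ s ∈ Finset.range (j + 1),
      j.choose s * (1 / 2 + α) ^ s * (1 - (1 / 2 + α)) ^ (j - s) / (1 + 2 * α) ^ s =
      (1 - α) ^ j := by
    rw [show 1 - α = 1 / 2 + (1 - (1 / 2 + α)) by ring, add_pow]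
    refine Finset.sum_congr rfl fun s _ => ?_
    rw [show (1 / 2 : ℝ) = (1 / 2 + α) / (1 + 2 * α) by field_simp, div_pow]
    rw [show (1 / 2 + α) / (1 + 2 * α) + α = 1 / 2 + α by field_simp]
    ring
  have hsplit : ∑ s ∈ Finset.range (j + 1),
      j.choose s * (1 / 2 + α) ^ s * (1 - (1 / 2 + α)) ^ (j - s) *
      (1 + 2 * (((1 + (1 + 2 * α)) / 2) ^ (j + 1) / (1 + 2 * α) ^ (s + 1))) =
      1 + 2 * ((1 + α) / (1 + 2 * α)) * ((1 + α) ^ j * (1 - α) ^ j) := by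
    rw [← hmgf, Finset.mul_sum, Finset.mul_sum]
    refine Eq.trans ?_ (congrArg (· + _) hone)
    rw [← Finset.sum_add_distrib]
    refine Finset.sum_congr rfl fun s _ => ?_
    rw [show (1 + (1 + 2 * α)) / 2 = 1 + α by ring, pow_succ, pow_succ (1 + 2 * α)]
    field_simp
  rw [hsplit, ← mul_pow]
  have hexp : ((1 + α) * (1 - α)) ^ j ≤ Real.exp (-(α ^ 2) * j) := by
    rw [mul_comm _ (j : ℝ), Real.exp_nat_mul]
    refine pow_le_pow_left₀ (mul_nonneg (by linarith) (by linarith)) ?_ j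
    linarith [Real.add_one_le_exp (-(α ^ 2))]
  have hfrac : (1 + α) / (1 + 2 * α) ≤ 1 := by
    rw [div_le_one hz]
    linarith
  have hnn : 0 ≤ (1 + α) / (1 + 2 * α) := by positivity
  nlinarith [mul_le_mul hfrac hexp (pow_nonneg (mul_nonneg (by linarith) (by linarith)) j)
    zero_le_one]

/-- The pointwise bound in the lower half of the range. -/
lemma binomial_div_binCDF_le {α : ℝ} (h0 : 0 < α) (h1 : α ≤ 1 / 2) {j s m : ℕ} (hm : 1 ≤ m)
    (hj : j = 2 * s + m) :
    j.choose s * (1 / 2 + α) ^ s * (1 - (1 / 2 + α)) ^ (j - s) / binCDF (j + 1) (1 / 2) s ≤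
      2 * Real.exp (-2 * α ^ 2 * j) *
        ((6 / (j + 1)) * (m * Real.exp (-α) ^ m) +
          2 / Real.sqrt (j + 1) * Real.exp (-α) ^ m) := by
  have hN : (0 : ℝ) < chooseSum (j + 1) s := by exact_mod_cast chooseSum_pos (j + 1) s
  have hhaz := choose_le_mul_chooseSum (j + 1) s (by omega)
  have hm1 : (1 : ℝ) ≤ m := by exact_mod_cast hm
  have hjR : (j : ℝ) = 2 * s + m := by exact_mod_cast hj
  have hj0 : (0 : ℝ) ≤ j := by positivity
  have hV : (2 * (((j + 1 : ℕ) : ℝ) + 1 - 2 * s) / ((j + 1 : ℕ) + 2) +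
      2 / Real.sqrt ((j + 1 : ℕ) + 2)) ≤ 6 / (j + 1) * m + 2 / Real.sqrt (j + 1) := by
    push_cast
    refine add_le_add ?_ ?_
    · rw [div_mul_eq_mul_div]
      exact div_le_div₀ (by positivity) (by linarith) (by positivity) (by linarith)
    · refine div_le_div_of_nonneg_left (by norm_num) (by positivity) ?_
      exact Real.sqrt_le_sqrt (by linarith)
  have hchoose : (j.choose s : ℝ) ≤
      (6 / (j + 1) * m + 2 / Real.sqrt (j + 1)) * chooseSum (j + 1) s := by
    refine le_trans ?_ (hhaz.trans (mul_le_mul_of_nonneg_right hV hN.le))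
    exact_mod_cast Nat.choose_le_succ j s
  have hpow : (1 / 2 + α) ^ s * (1 - (1 / 2 + α)) ^ (j - s) * 2 ^ (j + 1) ≤
      2 * (Real.exp (-2 * α ^ 2 * j) * Real.exp (-α) ^ m) := by
    have e : (1 / 2 + α) ^ s * (1 - (1 / 2 + α)) ^ (j - s) * 2 ^ (j + 1) =
        2 * ((1 - 4 * α ^ 2) ^ s * (1 - 2 * α) ^ m) := by
      rw [show j - s = s + m by omega, show j + 1 = s + (s + m) + 1 by omega, pow_succ,
        pow_add 2 s, show (1 - 4 * α ^ 2) = ((1 / 2 + α) * 2) * ((1 - (1 / 2 + α)) * 2) by ring,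
        show (1 - 2 * α) = (1 - (1 / 2 + α)) * 2 by ring, mul_pow, mul_pow, mul_pow, mul_pow,
        pow_add, pow_add]
      ring
    rw [e]
    have e1 : (1 - 4 * α ^ 2) ^ s ≤ Real.exp (s * (-(4 * α ^ 2))) := by
      rw [Real.exp_nat_mul]
      exact pow_le_pow_left₀ (by nlinarith) (by linarith [Real.add_one_le_exp (-(4 * α ^ 2))]) s
    have e2 : (1 - 2 * α) ^ m ≤ Real.exp (m * (-(2 * α))) := by
      rw [Real.exp_nat_mul]
      exact pow_le_pow_left₀ (by linarith) (by linarith [Real.add_one_le_exp (-(2 * α))]) m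
    refine mul_le_mul_of_nonneg_left ?_ (by norm_num)
    refine (mul_le_mul e1 e2 (pow_nonneg (by linarith) m) (Real.exp_pos _).le).trans ?_
    rw [← Real.exp_nat_mul, ← Real.exp_add, ← Real.exp_add, Real.exp_le_exp, hjR]
    have : α ^ 2 * 2 ≤ α := by nlinarith
    nlinarith
  have hnn : 0 ≤ (1 / 2 + α) ^ s * (1 - (1 / 2 + α)) ^ (j - s) * 2 ^ (j + 1) :=
    mul_nonneg (mul_nonneg (by positivity) (pow_nonneg (by linarith) _)) (by positivity)
  rw [binCDF_half, div_div_eq_mul_div, div_le_iff₀ hN]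
  have := mul_le_mul hchoose hpow hnn (by positivity)
  calc _ = (j.choose s : ℝ) * ((1 / 2 + α) ^ s * (1 - (1 / 2 + α)) ^ (j - s) * 2 ^ (j + 1)) := by
        ring
    _ ≤ _ := this
    _ = _ := by ring

lemma sum_exp_neg_pow_le {α : ℝ} (h0 : 0 < α) (h1 : α ≤ 1 / 2) (N : ℕ) :
    ∑ m ∈ Finset.range N, Real.exp (-α) ^ m ≤ 3 / (2 * α) ∧
      ∑ m ∈ Finset.range N, m * Real.exp (-α) ^ m ≤ 9 / (4 * α ^ 2) := by
  have hr0 := Real.exp_pos (-α)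
  have hr : 2 * α / 3 ≤ 1 - Real.exp (-α) := by
    have h : Real.exp (-α) ≤ 1 / (1 + α) := by
      rw [Real.exp_neg, ← one_div]
      exact one_div_le_one_div_of_le (by linarith) (by linarith [Real.add_one_le_exp α])
    have h' : 1 / (1 + α) ≤ 1 - 2 * α / 3 := by
      rw [div_le_iff₀ (by linarith)]
      nlinarith
    linarith
  set r := Real.exp (-α)
  have hr1 : r < 1 := by linarith
  have hnorm : ‖r‖ < 1 := by rwa [Real.norm_of_nonneg hr0.le]
  constructor
  · refine ((summable_geometric_of_lt_one hr0.le hr1).sum_le_tsum _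
      fun _ _ => by positivity).trans ?_
    rw [tsum_geometric_of_lt_one hr0.le hr1, ← one_div,
      show 3 / (2 * α) = 1 / (2 * α / 3) by field_simp]
    exact one_div_le_one_div_of_le (by positivity) hr
  · refine ((hasSum_coe_mul_geometric_of_norm_lt_one hnorm).summable.sum_le_tsum _
      fun _ _ => by positivity).trans ?_
    rw [tsum_coe_mul_geometric_of_norm_lt_one hnorm,
      show 9 / (4 * α ^ 2) = 1 / (2 * α / 3) ^ 2 by field_simp; norm_num]
    exact div_le_div₀ zero_le_one hr1.le (by positivity)
      (pow_le_pow_left₀ (by positivity) hr 2)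

/-- The contribution of the lower half of the range. -/
lemma sum_lower_half_le {α : ℝ} (h0 : 0 < α) (h1 : α ≤ 1 / 2) (j : ℕ) :
    ∑ s ∈ Finset.range (j + 1) with 2 * s < j,
      j.choose s * (1 / 2 + α) ^ s * (1 - (1 / 2 + α)) ^ (j - s) / binCDF (j + 1) (1 / 2) s ≤
    Real.exp (-2 * α ^ 2 * j) * (3 + 30 / (α ^ 2 * (j + 1))) := by
  set g : ℕ → ℝ := fun m => 2 * Real.exp (-2 * α ^ 2 * j) *
    ((6 / (j + 1)) * (m * Real.exp (-α) ^ m) + 2 / Real.sqrt (j + 1) * Real.exp (-α) ^ m)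
    with hg
  have hsum : ∑ s ∈ Finset.range (j + 1) with 2 * s < j,
      j.choose s * (1 / 2 + α) ^ s * (1 - (1 / 2 + α)) ^ (j - s) / binCDF (j + 1) (1 / 2) s ≤
      ∑ m ∈ Finset.range (j + 1), g m := by
    calc _ ≤ ∑ s ∈ Finset.range (j + 1) with 2 * s < j, g (j - 2 * s) := by
          refine Finset.sum_le_sum fun s hs => ?_
          have := (Finset.mem_filter.1 hs).2
          exact binomial_div_binCDF_le h0 h1 (by omega) (by omega)
      _ = ∑ m ∈ ({s ∈ Finset.range (j + 1) | 2 * s < j}).image (fun s => j - 2 * s), g m := by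
          rw [Finset.sum_image]
          intro s hs t ht hst
          simp only [Finset.coe_filter, Set.mem_ofPred_eq] at hs ht hst
          omega
      _ ≤ _ := by
          refine Finset.sum_le_sum_of_subset_of_nonneg ?_ fun m _ _ => by positivity
          intro m hm
          obtain ⟨s, -, rfl⟩ := Finset.mem_image.1 hm
          rw [Finset.mem_range]
          omega
  refine hsum.trans ?_
  obtain ⟨hA, hB⟩ := sum_exp_neg_pow_le h0 h1 (j + 1)
  rw [hg, ← Finset.mul_sum, Finset.sum_add_distrib, ← Finset.mul_sum, ← Finset.mul_sum]
  have hn : (0 : ℝ) < j + 1 := by positivity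
  have e1 := mul_le_mul_of_nonneg_left hB (show (0 : ℝ) ≤ 6 / (j + 1) by positivity)
  have e2 := mul_le_mul_of_nonneg_left hA (show 0 ≤ 2 / Real.sqrt (j + 1 : ℝ) by positivity)
  have e3 : 2 / Real.sqrt (j + 1 : ℝ) * (3 / (2 * α)) ≤ 3 / 2 + 3 / 2 / (α ^ 2 * (j + 1)) := by
    have hs : 1 / (α ^ 2 * (j + 1)) = (1 / (α * Real.sqrt (j + 1 : ℝ))) ^ 2 := by
      rw [div_pow, mul_pow, Real.sq_sqrt hn.le, one_pow]
    have ht : 2 / Real.sqrt (j + 1 : ℝ) * (3 / (2 * α)) =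
        3 * (1 / (α * Real.sqrt (j + 1 : ℝ))) := by
      field_simp
    rw [div_eq_mul_one_div (3 / 2 : ℝ) (α ^ 2 * (j + 1)), hs, ht]
    nlinarith [sq_nonneg (1 / (α * Real.sqrt (j + 1 : ℝ)) - 1)]
  have e4 : 6 / (j + 1 : ℝ) * (9 / (4 * α ^ 2)) = 27 / 2 * (1 / (α ^ 2 * (j + 1))) := by
    field_simp
    norm_num
  rw [mul_assoc, mul_left_comm]
  refine mul_le_mul_of_nonneg_left ?_ (Real.exp_pos _).le
  rw [e4] at e1
  rw [div_eq_mul_one_div (30 : ℝ)]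
  rw [div_eq_mul_one_div (3 / 2 : ℝ) (α ^ 2 * (j + 1))] at e3
  linarith

theorem stmt_3 :
    ∃ C₁ > (0 : ℝ), ∃ C₂ > (0 : ℝ),
      ∀ (α : ℝ), 0 < α → α ≤ 1 / 2 →
      ∀ (j : ℕ), 8 / α < (j : ℝ) →
      ∀ (p : Fin j → ℝ), (∀ l, 0 ≤ p l) → (∀ l, p l ≤ 1) →
        (∀ l, 1 / 2 + α ≤ p l) →
        ∑ s ∈ Finset.range (j + 1), bernCount j p s / binCDF (j + 1) (1 / 2) s
          ≤ 1 + 1 / (Real.exp (α ^ 2 * j / 4) - 1)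
            + Real.exp (-(α ^ 2) * j / 2)
              * (C₁ + C₂ * (1 - 2 * α) / (4 * α ^ 2 * (j + 1))) := by
  refine ⟨20, by norm_num, 120, by norm_num, ?_⟩
  intro α h0 h1 j hj p _ hp1 hp
  refine (sum_bernCount_div_binCDF_le (by linarith) hp1 hp (j + 1)).trans ?_
  have hupper : ∑ s ∈ Finset.range (j + 1) with ¬ 2 * s < j,
      j.choose s * (1 / 2 + α) ^ s * (1 - (1 / 2 + α)) ^ (j - s) / binCDF (j + 1) (1 / 2) s ≤
      1 + 2 * Real.exp (-(α ^ 2) * j) := by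
    refine le_trans ?_ (sum_binomial_mul_tail_le h0 h1 j)
    refine le_trans (Finset.sum_le_sum fun s hs => ?_)
      (Finset.sum_le_sum_of_subset_of_nonneg (Finset.filter_subset _ _) fun s _ _ => ?_)
    · have hhalf := half_le_binCDF_half (n := j + 1) (s := s)
        (by have := (Finset.mem_filter.1 hs).2; omega)
      have htail := one_sub_binCDF_half_le (j + 1) s (z := 1 + 2 * α) (by linarith)
      rw [div_eq_mul_one_div]
      refine mul_le_mul_of_nonneg_left ?_
        (mul_nonneg (by positivity) (pow_nonneg (by linarith) _))
      rw [div_le_iff₀ (by linarith)]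
      have hnn : 0 ≤ ((1 + (1 + 2 * α)) / 2) ^ (j + 1) / (1 + 2 * α) ^ (s + 1) := by positivity
      nlinarith [mul_nonneg hnn (sub_nonneg.2 hhalf)]
    · exact mul_nonneg (mul_nonneg (by positivity) (pow_nonneg (by linarith) _)) (by positivity)
  rw [← Finset.sum_filter_add_sum_filter_not _ (fun s => 2 * s < j)]
  refine (add_le_add (sum_lower_half_le h0 h1 j) hupper).trans ?_
  have hαj : 8 < α * j := by
    rw [div_lt_iff₀ h0] at hj
    linarith
  have hx : 0 < α ^ 2 * j := by nlinarith
  have hfirst : 0 ≤ 1 / (Real.exp (α ^ 2 * j / 4) - 1) :=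
    one_div_nonneg.2 (sub_nonneg.2 (Real.one_le_exp (by positivity)))
  have hE1 : Real.exp (-(α ^ 2) * j) ≤ Real.exp (-(α ^ 2) * j / 2) :=
    Real.exp_le_exp.2 (by linarith)
  have hE2 : Real.exp (-2 * α ^ 2 * j) ≤ Real.exp (-(α ^ 2) * j / 2) :=
    Real.exp_le_exp.2 (by linarith)
  have hcoef : 30 / (α ^ 2 * (j + 1)) ≤
      15 / 2 + 120 * (1 - 2 * α) / (4 * α ^ 2 * (j + 1)) := by
    have hsplit : 30 / (α ^ 2 * (j + 1)) =
        60 / (α * (j + 1)) + 120 * (1 - 2 * α) / (4 * α ^ 2 * (j + 1)) := by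
      field_simp
      ring
    have hsmall : 60 / (α * (j + 1)) ≤ 15 / 2 := by
      rw [div_le_iff₀ (by positivity)]
      linarith
    linarith
  have hprod := mul_le_mul hE2 (add_le_add_right hcoef 3) (by positivity) (Real.exp_pos _).le
  linarith [Real.exp_pos (-(α ^ 2) * j / 2)]
end

section
/- For every α ∈ (0, 1/2), every integer j ≥ 2, and every p = (p_1,…,p_j) ∈ [0,1]^j with p_l ≥ 1/2 + α for all l, one has f_p(j, ⌊j/2⌋) / F_{j+1,1/2}(⌊j/2⌋) ≤ 2 · exp(−α²j). -/
open Finset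

open Polynomial in
/-- The probability generating function of a sum of independent Bernoulli trials whose success
probabilities are listed in `M`. -/
noncomputable def bernGF (M : Multiset ℝ) : ℝ[X] :=
  (M.map fun p => C (1 - p) + C p * X).prod

lemma bernGF_cons (p : ℝ) (M : Multiset ℝ) :
    bernGF (p ::ₘ M) =
      (Polynomial.C (1 - p) + Polynomial.C p * Polynomial.X) * bernGF M := by
  simp [bernGF]

lemma coeff_zero_bernGF_cons (p : ℝ) (M : Multiset ℝ) :
    (bernGF (p ::ₘ M)).coeff 0 = (1 - p) * (bernGF M).coeff 0 := by
  simp [bernGF_cons, Polynomial.mul_coeff_zero]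

lemma coeff_succ_bernGF_cons (p : ℝ) (M : Multiset ℝ) (s : ℕ) :
    (bernGF (p ::ₘ M)).coeff (s + 1) =
      p * (bernGF M).coeff s + (1 - p) * (bernGF M).coeff (s + 1) := by
  rw [bernGF_cons, add_mul, Polynomial.coeff_add, Polynomial.coeff_C_mul, mul_assoc,
    Polynomial.coeff_C_mul, Polynomial.coeff_X_mul]
  ring

lemma coeff_bernGF_nonneg (M : Multiset ℝ) (hM : ∀ p ∈ M, 0 ≤ p ∧ p ≤ 1) (s : ℕ) :
    0 ≤ (bernGF M).coeff s := by
  induction M using Multiset.induction_on generalizing s with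
  | empty =>
    simp only [bernGF, Multiset.map_zero, Multiset.prod_zero, Polynomial.coeff_one]
    split_ifs <;> norm_num
  | cons p M ih =>
    obtain ⟨h0, h1⟩ := hM p (Multiset.mem_cons_self p M)
    have ih := ih fun q hq => hM q (Multiset.mem_cons_of_mem hq)
    have h1' : 0 ≤ 1 - p := sub_nonneg.2 h1
    cases s with
    | zero => rw [coeff_zero_bernGF_cons]; exact mul_nonneg h1' (ih 0)
    | succ s =>
      rw [coeff_succ_bernGF_cons]
      exact add_nonneg (mul_nonneg h0 (ih s)) (mul_nonneg h1' (ih (s + 1)))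

/-- If every success probability is at least `1 / 2`, then `i` successes are at most as likely as
`k` successes whenever `i ≤ k` and `i + k` is at most the number of trials. -/
lemma coeff_bernGF_le_coeff (M : Multiset ℝ) (hM : ∀ p ∈ M, 1 / 2 ≤ p ∧ p ≤ 1) (i k : ℕ)
    (hik : i ≤ k) (hsum : i + k ≤ M.card) :
    (bernGF M).coeff i ≤ (bernGF M).coeff k := by
  induction M using Multiset.induction_on generalizing i k with
  | empty =>
    rw [Multiset.card_zero] at hsum
    obtain rfl : i = k := by omega
    exact le_rfl
  | cons p M ih =>
    obtain ⟨h0, h1⟩ := hM p (Multiset.mem_cons_self p M)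
    have hM' : ∀ q ∈ M, 1 / 2 ≤ q ∧ q ≤ 1 := fun q hq => hM q (Multiset.mem_cons_of_mem hq)
    have ih := ih hM'
    have hnn := coeff_bernGF_nonneg M fun q hq => ⟨by linarith [(hM' q hq).1], (hM' q hq).2⟩
    rw [Multiset.card_cons] at hsum
    obtain rfl | hlt := hik.eq_or_lt
    · exact le_rfl
    obtain ⟨k, rfl⟩ : ∃ k', k = k' + 1 := ⟨k - 1, by omega⟩
    have hBC := ih i k (by omega) (by omega)
    rw [coeff_succ_bernGF_cons]
    cases i with
    | zero =>
      rw [coeff_zero_bernGF_cons]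
      nlinarith [hnn k, hnn (k + 1)]
    | succ i =>
      have hAC := ih i k (by omega) (by omega)
      have hAD := ih i (k + 1) (by omega) (by omega)
      rw [coeff_succ_bernGF_cons]
      nlinarith

lemma coeff_bernGF_replicate (a : ℝ) (n s : ℕ) :
    (bernGF (Multiset.replicate n a)).coeff s = n.choose s * a ^ s * (1 - a) ^ (n - s) := by
  induction n generalizing s with
  | zero => cases s <;> simp [bernGF, Polynomial.coeff_one]
  | succ n ih =>
    rw [Multiset.replicate_succ]
    cases s with
    | zero => rw [coeff_zero_bernGF_cons, ih]; simp; ring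
    | succ s =>
      rw [coeff_succ_bernGF_cons, ih, ih, Nat.choose_succ_succ, Nat.add_sub_add_right]
      obtain h | h := lt_or_ge s n
      · obtain ⟨d, rfl⟩ := Nat.exists_eq_add_of_lt h
        rw [show s + d + 1 - s = d + 1 by omega, show s + d + 1 - (s + 1) = d by omega]
        push_cast; ring
      · rw [Nat.choose_eq_zero_of_lt (by omega : n < s + 1)]
        push_cast; ring

/-- At most half of the trials succeeding is likeliest when all success probabilities, known to be
at least `a ≥ 1 / 2`, are equal to `a`. -/
lemma coeff_bernGF_add_replicate_le (a : ℝ) (ha : 1 / 2 ≤ a) (ha1 : a ≤ 1) (M : Multiset ℝ)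
    (hM : ∀ p ∈ M, a ≤ p ∧ p ≤ 1) (k s : ℕ) (hs : 2 * s ≤ M.card + k) :
    (bernGF (M + Multiset.replicate k a)).coeff s ≤
      (bernGF (Multiset.replicate (M.card + k) a)).coeff s := by
  induction M using Multiset.induction_on generalizing k with
  | empty => simp
  | cons p M ih =>
    obtain ⟨hp, hp1⟩ := hM p (Multiset.mem_cons_self p M)
    have hM' : ∀ q ∈ M, a ≤ q ∧ q ≤ 1 := fun q hq => hM q (Multiset.mem_cons_of_mem hq)
    rw [Multiset.card_cons] at hs ⊢
    have ih := ih hM' (k + 1) (by omega)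
    rw [Multiset.replicate_succ, Multiset.add_cons, ← add_assoc, add_right_comm] at ih
    refine le_trans ?_ ih
    rw [Multiset.cons_add]
    have hQ : ∀ q ∈ M + Multiset.replicate k a, 1 / 2 ≤ q ∧ q ≤ 1 := by
      intro q hq
      obtain hq | hq := Multiset.mem_add.1 hq
      · exact ⟨ha.trans (hM' q hq).1, (hM' q hq).2⟩
      · rw [Multiset.eq_of_mem_replicate hq]; exact ⟨ha, ha1⟩
    cases s with
    | zero =>
      rw [coeff_zero_bernGF_cons, coeff_zero_bernGF_cons]
      have := coeff_bernGF_nonneg _ (fun q hq => ⟨by linarith [(hQ q hq).1], (hQ q hq).2⟩) 0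
      gcongr
    | succ s =>
      rw [coeff_succ_bernGF_cons, coeff_succ_bernGF_cons]
      have := coeff_bernGF_le_coeff _ hQ s (s + 1) (by omega)
        (by rw [Multiset.card_add, Multiset.card_replicate]; omega)
      nlinarith

lemma bernCount_eq_coeff (j : ℕ) (p : Fin j → ℝ) (s : ℕ) :
    bernCount j p s = (bernGF (Finset.univ.val.map p)).coeff s := by
  have hterm (t : Finset (Fin j)) :
      ((∏ l ∈ t, Polynomial.C (p l) * Polynomial.X) *
        ∏ l ∈ Finset.univ \ t, Polynomial.C (1 - p l)).coeff s =
      if t.card = s then (∏ l ∈ t, p l) * ∏ l ∈ tᶜ, (1 - p l) else 0 := by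
    rw [Finset.prod_mul_distrib, Finset.prod_const, ← map_prod, ← map_prod, mul_right_comm,
      ← Polynomial.C_mul, Polynomial.coeff_C_mul_X_pow, ← Finset.compl_eq_univ_sdiff]
    simp only [eq_comm]
  have hprod : bernGF (Finset.univ.val.map p) =
      ∏ l, (Polynomial.C (p l) * Polynomial.X + Polynomial.C (1 - p l)) := by
    rw [bernGF, Multiset.map_map]
    exact Finset.prod_congr rfl fun l _ => add_comm _ _
  rw [hprod, Finset.prod_add, Polynomial.finsetSum_coeff, Finset.sum_congr rfl fun t _ => hterm t,
    ← Finset.sum_filter, ← Finset.powersetCard_eq_filter, bernCount]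

/-- The probability of at most half of `j` trials succeeding is largest at the smallest common
success probability. -/
lemma bernCount_le (a : ℝ) (ha : 1 / 2 ≤ a) (j : ℕ) (p : Fin j → ℝ)
    (hp : ∀ l, a ≤ p l) (hp1 : ∀ l, p l ≤ 1) (ha1 : a ≤ 1) (s : ℕ) (hs : 2 * s ≤ j) :
    bernCount j p s ≤ j.choose s * a ^ s * (1 - a) ^ (j - s) := by
  have h := coeff_bernGF_add_replicate_le a ha ha1 (Finset.univ.val.map p)
    (by simpa using fun l => ⟨hp l, hp1 l⟩) 0 s (by simpa using hs)
  rw [bernCount_eq_coeff, ← coeff_bernGF_replicate]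
  simpa using h

lemma binCDF_half_s5 (n s : ℕ) (hs : s ≤ n) :
    binCDF n (1 / 2) s = (∑ k ∈ Finset.range (s + 1), n.choose k : ℕ) / 2 ^ n := by
  rw [binCDF, Nat.cast_sum, Finset.sum_div]
  refine Finset.sum_congr rfl fun k hk => ?_
  have hk : k ≤ n := (Finset.mem_range_succ_iff.1 hk).trans hs
  rw [show (1 : ℝ) - 1 / 2 = 1 / 2 by norm_num, mul_assoc, ← pow_add, Nat.add_sub_cancel' hk,
    one_div, inv_pow, div_eq_mul_inv]

lemma binCDF_half_odd (m : ℕ) : binCDF (2 * m + 1) (1 / 2) m = 1 / 2 := by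
  rw [binCDF_half_s5 _ _ (by omega), Nat.sum_range_choose_halfway]
  push_cast
  rw [pow_succ, pow_mul]
  norm_num
  field_simp

lemma sum_range_choose_halfway_even (m : ℕ) :
    ∑ k ∈ Finset.range (m + 1), (2 * m + 2).choose k + (2 * m + 1).choose m = 2 * 4 ^ m := by
  have h := Nat.sum_range_choose_halfway m
  rw [Finset.sum_range_succ']
  simp only [Nat.choose_succ_succ (2 * m + 1), Finset.sum_add_distrib]
  have h1 := Finset.sum_range_succ (fun k => (2 * m + 1).choose k) m
  have h2 := Finset.sum_range_succ' (fun k => (2 * m + 1).choose k) m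
  simp only [Nat.choose_zero_right, Nat.succ_eq_add_one] at *
  omega

lemma binCDF_half_even (m : ℕ) :
    binCDF (2 * m + 2) (1 / 2) m = (2 - (2 * m + 1).choose m / 4 ^ m) / 4 := by
  have h : ((∑ k ∈ Finset.range (m + 1), (2 * m + 2).choose k : ℕ) : ℝ) =
      2 * 4 ^ m - (2 * m + 1).choose m := by
    rw [eq_sub_iff_add_eq]; exact_mod_cast sum_range_choose_halfway_even m
  rw [binCDF_half_s5 _ _ (by omega), h, pow_add, pow_mul]
  norm_num
  field_simp

lemma one_sub_four_mul_sq_pow_le_exp (α : ℝ) (hα0 : 0 ≤ α) (hα : α ≤ 1 / 2) (m : ℕ) :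
    (1 - 4 * α ^ 2) ^ m ≤ Real.exp (-(4 * α ^ 2) * m) := by
  rw [mul_comm (-(4 * α ^ 2)), Real.exp_nat_mul]
  exact pow_le_pow_left₀ (by nlinarith) (by linarith [Real.add_one_le_exp (-(4 * α ^ 2))]) m

theorem stmt_5 (α : ℝ) (hα0 : 0 < α) (hα : α < 1 / 2)
    (j : ℕ) (hj : 2 ≤ j)
    (p : Fin j → ℝ) (hp0 : ∀ l, 0 ≤ p l) (hp1 : ∀ l, p l ≤ 1)
    (hp : ∀ l, 1 / 2 + α ≤ p l) :
    bernCount j p (j / 2) / binCDF (j + 1) (1 / 2) (j / 2)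
      ≤ 2 * Real.exp (-(α ^ 2) * j) := by
  have hf := bernCount_le (1 / 2 + α) (by linarith) j p hp hp1 (by linarith) (j / 2) (by omega)
  set m := j / 2 with hm
  have hm1 : (1 : ℝ) ≤ m := by exact_mod_cast (by omega : 1 ≤ m)
  have hE := one_sub_four_mul_sq_pow_le_exp α hα0.le hα.le m
  have hE0 : 0 ≤ (1 - 4 * α ^ 2) ^ m := pow_nonneg (by nlinarith) m
  have hab : (1 / 2 + α) ^ m * (1 - (1 / 2 + α)) ^ m = (1 - 4 * α ^ 2) ^ m / 4 ^ m := by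
    rw [← mul_pow, ← div_pow]; congr 1; ring
  have h4 : (0 : ℝ) < 4 ^ m := by positivity
  clear_value m
  obtain rfl | rfl : j = 2 * m ∨ j = 2 * m + 1 := by omega
  · have hc : ((2 * m).choose m : ℝ) ≤ 4 ^ m := by
      have := Nat.choose_le_two_pow (2 * m) m
      rw [pow_mul] at this
      exact_mod_cast this
    rw [show 2 * m - m = m by omega, mul_assoc, hab] at hf
    rw [binCDF_half_odd, div_le_iff₀ (by norm_num)]
    calc bernCount (2 * m) p m
        ≤ 4 ^ m * ((1 - 4 * α ^ 2) ^ m / 4 ^ m) := hf.trans (by gcongr)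
      _ = (1 - 4 * α ^ 2) ^ m := by field_simp
      _ ≤ Real.exp (-(α ^ 2) * (2 * m : ℕ)) := hE.trans (by
        rw [Real.exp_le_exp]; push_cast; nlinarith [sq_nonneg α])
      _ = _ := by ring
  · have hc : ((2 * m + 1).choose m : ℝ) / 4 ^ m ≤ 1 := by
      rw [div_le_one h4]
      exact_mod_cast Nat.choose_middle_le_pow m
    have hc0 : (0 : ℝ) ≤ ((2 * m + 1).choose m : ℝ) / 4 ^ m := by positivity
    rw [show 2 * m + 1 - m = m + 1 by omega, pow_succ, mul_assoc, ← mul_assoc (_ ^ m), hab] at hf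
    rw [binCDF_half_even, div_le_iff₀ (by linarith)]
    have hexp : (1 - 4 * α ^ 2) ^ m ≤ Real.exp (-(α ^ 2) * (2 * m + 1 : ℕ)) := hE.trans (by
      rw [Real.exp_le_exp]; push_cast; nlinarith [sq_nonneg α])
    set c : ℝ := ((2 * m + 1).choose m : ℝ) / 4 ^ m
    set E := Real.exp (-(α ^ 2) * (2 * m + 1 : ℕ))
    have hE1 : 0 ≤ E := (Real.exp_pos _).le
    calc bernCount (2 * m + 1) p m
        ≤ c * ((1 - 4 * α ^ 2) ^ m * (1 - (1 / 2 + α))) := hf.trans_eq (by ring)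
      _ ≤ 1 * (E * (1 / 2)) := by
        gcongr
        · exact mul_nonneg hE0 (by linarith)
        · linarith
        · linarith
      _ ≤ 2 * E * ((2 - c) / 4) := by nlinarith
end
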